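/- arXiv:2104.08347 — 4 statements merged into one kernel-verified Lean document; each statement's English description precedes it below -/
import Mathlib

section
/- Let 𝒜 = [a_{ij}] ∈ ℝ^{N×N} with a_{ij} ≥ 0 and a_{ii} = 0, and let L = [ℓ_{ij}] be its Laplacian. Assume the directed graph of 𝒜 contains a directed spanning tree, i.e. there is a node r from which every node is reachable by a directed path. Then 0 is a root of the characteristic polynomial of L of multiplicity exactly one, and every nonzero complex eigenvalue of L has strictly positive real part. -/
open Matrix Polynomial

noncomputable section

/-- Laplacian of a weight matrix. -/
def Lap {N : ℕ} (A : Matrix (Fin N) (Fin N) ℝ) : Matrix (Fin N) (Fin N) ℝ :=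
  Matrix.of fun i j => if i = j then ∑ k, A i k else -A i j

theorem Lap_mulVec_apply {N : ℕ} {A : Matrix (Fin N) (Fin N) ℝ} (hdiag : ∀ i, A i i = 0)
    (x : Fin N → ℝ) (i : Fin N) : (Lap A *ᵥ x) i = ∑ k, A i k * (x i - x k) := by
  have h : ∀ k, Lap A i k * x k = (if i = k then (∑ l, A i l) * x k else 0) - A i k * x k := by
    intro k
    rcases eq_or_ne i k with rfl | hik
    · simp [Lap, hdiag]
    · simp [Lap, hik]
  simp only [mulVec, dotProduct, h, Finset.sum_sub_distrib, mul_sub, Finset.sum_mul]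
  simp

theorem Lap_mulVec_one {N : ℕ} {A : Matrix (Fin N) (Fin N) ℝ} (hdiag : ∀ i, A i i = 0) :
    Lap A *ᵥ (1 : Fin N → ℝ) = 0 := by
  ext i
  simp [Lap_mulVec_apply hdiag]

theorem exists_Lap_mulVec_nonneg {N : ℕ} [Nonempty (Fin N)] {A : Matrix (Fin N) (Fin N) ℝ}
    (hnonneg : ∀ i j, 0 ≤ A i j) (hdiag : ∀ i, A i i = 0) (x : Fin N → ℝ) :
    ∃ i, 0 ≤ (Lap A *ᵥ x) i := by
  obtain ⟨m, hm⟩ := Finite.exists_max x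
  refine ⟨m, ?_⟩
  rw [Lap_mulVec_apply hdiag]
  exact Finset.sum_nonneg fun k _ => mul_nonneg (hnonneg m k) (sub_nonneg.2 (hm k))

/-- Maximum principle: a subharmonic vector attains its maximum at any root of the graph. -/
theorem le_root_of_Lap_mulVec_nonpos {N : ℕ} {A : Matrix (Fin N) (Fin N) ℝ}
    (hnonneg : ∀ i j, 0 ≤ A i j) (hdiag : ∀ i, A i i = 0) {r : Fin N}
    (hr : ∀ i, Relation.ReflTransGen (fun u v : Fin N => 0 < A v u) r i)
    {x : Fin N → ℝ} (hx : ∀ i, (Lap A *ᵥ x) i ≤ 0) (i : Fin N) : x i ≤ x r := by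
  have : Nonempty (Fin N) := ⟨r⟩
  obtain ⟨m, hm⟩ := Finite.exists_max x
  suffices x r = x m from this ▸ hm i
  have hrm := hr m
  clear hr
  induction hrm using Relation.ReflTransGen.head_induction_on with
  | refl => rfl
  | @head u v huv _ ih =>
    have hterm : ∀ k ∈ Finset.univ, 0 ≤ A v k * (x v - x k) := fun k _ =>
      mul_nonneg (hnonneg v k) (sub_nonneg.2 (ih ▸ hm k))
    have hsum : ∑ k, A v k * (x v - x k) = 0 :=
      le_antisymm (Lap_mulVec_apply hdiag x v ▸ hx v) (Finset.sum_nonneg hterm)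
    have hu := (Finset.sum_eq_zero_iff_of_nonneg hterm).1 hsum u (Finset.mem_univ u)
    rcases mul_eq_zero.1 hu with h | h
    · exact absurd h huv.ne'
    · linarith

theorem mem_span_one_of_Lap_mulVec_mem_span_one {N : ℕ} {A : Matrix (Fin N) (Fin N) ℝ}
    (hnonneg : ∀ i j, 0 ≤ A i j) (hdiag : ∀ i, A i i = 0) {r : Fin N}
    (hr : ∀ i, Relation.ReflTransGen (fun u v : Fin N => 0 < A v u) r i)
    {x : Fin N → ℝ} (hx : Lap A *ᵥ x ∈ Submodule.span ℝ {(1 : Fin N → ℝ)}) :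
    x ∈ Submodule.span ℝ {(1 : Fin N → ℝ)} := by
  have : Nonempty (Fin N) := ⟨r⟩
  obtain ⟨c, hc⟩ := Submodule.mem_span_singleton.1 hx
  have hc' : ∀ i, (Lap A *ᵥ x) i = c := fun i => by simp [← hc]
  have hneg : ∀ i, (Lap A *ᵥ (-x)) i = -c := fun i => by simp [mulVec_neg, hc']
  obtain ⟨i, hi⟩ := exists_Lap_mulVec_nonneg hnonneg hdiag x
  obtain ⟨j, hj⟩ := exists_Lap_mulVec_nonneg hnonneg hdiag (-x)
  rw [hc'] at hi
  rw [hneg] at hj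
  refine Submodule.mem_span_singleton.2 ⟨x r, funext fun k => ?_⟩
  have h₁ := le_root_of_Lap_mulVec_nonpos hnonneg hdiag hr
    (fun i => (hc' i).trans_le (by linarith)) k
  have h₂ := le_root_of_Lap_mulVec_nonpos hnonneg hdiag hr
    (fun i => (hneg i).trans_le (by linarith)) k
  simp only [Pi.neg_apply] at h₂
  simp only [Pi.smul_apply, Pi.one_apply, smul_eq_mul, mul_one]
  linarith

theorem maxGenEigenspace_Lap_zero {N : ℕ} {A : Matrix (Fin N) (Fin N) ℝ}
    (hnonneg : ∀ i j, 0 ≤ A i j) (hdiag : ∀ i, A i i = 0) {r : Fin N}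
    (hr : ∀ i, Relation.ReflTransGen (fun u v : Fin N => 0 < A v u) r i) :
    Module.End.maxGenEigenspace (Matrix.toLin' (Lap A)) 0 = Submodule.span ℝ {(1 : Fin N → ℝ)} := by
  refine le_antisymm (fun x hx => ?_) ?_
  · obtain ⟨k, hk⟩ := (Module.End.mem_maxGenEigenspace _ _ _).1 hx
    rw [zero_smul, sub_zero] at hk
    clear hx
    induction k generalizing x with
    | zero =>
      rw [pow_zero, Module.End.one_apply] at hk
      exact hk ▸ Submodule.zero_mem _
    | succ k ih =>
      rw [pow_succ, Module.End.mul_apply] at hk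
      exact mem_span_one_of_Lap_mulVec_mem_span_one hnonneg hdiag hr (ih _ hk)
  · rw [Submodule.span_singleton_le_iff_mem, Module.End.mem_maxGenEigenspace]
    exact ⟨1, by simp [-map_one, Lap_mulVec_one hdiag]⟩

/-- By Gershgorin, nonzero eigenvalues of the Laplacian lie in the open right half plane. -/
theorem re_pos_of_isRoot_charpoly_Lap {N : ℕ} {A : Matrix (Fin N) (Fin N) ℝ}
    (hnonneg : ∀ i j, 0 ≤ A i j) (hdiag : ∀ i, A i i = 0) {μ : ℂ}
    (hμ : ((Lap A).charpoly.map (algebraMap ℝ ℂ)).IsRoot μ) (h0 : μ ≠ 0) : 0 < μ.re := by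
  rw [← Matrix.charpoly_map, ← Matrix.charpoly_toLin',
    ← Module.End.hasEigenvalue_iff_isRoot_charpoly] at hμ
  obtain ⟨k, hk⟩ := eigenvalue_mem_ball hμ
  have hrad : ∑ j ∈ Finset.univ.erase k, ‖(Lap A).map (algebraMap ℝ ℂ) k j‖ = ∑ j, A k j := by
    rw [← Finset.sum_erase (a := k) Finset.univ (hdiag k)]
    refine Finset.sum_congr rfl fun j hj => ?_
    simp [Lap, (Finset.ne_of_mem_erase hj).symm, abs_of_nonneg (hnonneg k j)]
  have hcenter : (Lap A).map (algebraMap ℝ ℂ) k k = ((∑ j, A k j : ℝ) : ℂ) := by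
    simp [Lap]
  rw [hrad, hcenter, Metric.mem_closedBall, dist_eq_norm] at hk
  have hd : 0 ≤ ∑ j, A k j := Finset.sum_nonneg fun j _ => hnonneg k j
  generalize ∑ j, A k j = d at hk hd
  have hsq : (μ.re - d) ^ 2 + μ.im ^ 2 ≤ d ^ 2 := by
    have h := pow_le_pow_left₀ (norm_nonneg _) hk 2
    rw [Complex.sq_norm, Complex.normSq_apply] at h
    simp only [Complex.sub_re, Complex.sub_im, Complex.ofReal_re, Complex.ofReal_im] at h
    nlinarith
  by_contra! hre
  have hprod : 0 ≤ d * -μ.re := mul_nonneg hd (neg_nonneg.2 hre)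
  refine h0 (Complex.ext ?_ ?_)
  · exact pow_eq_zero_iff two_ne_zero |>.1 (by nlinarith [sq_nonneg μ.re, sq_nonneg μ.im])
  · exact pow_eq_zero_iff two_ne_zero |>.1 (by nlinarith [sq_nonneg μ.re, sq_nonneg μ.im])

/-- If the directed graph of the nonnegative weight matrix `𝒜` (zero diagonal)
contains a directed spanning tree, then `0` is a root of the characteristic
polynomial of the Laplacian `L` of multiplicity exactly one, and every nonzero
complex eigenvalue of `L` has strictly positive real part. -/
theorem laplacian_spanning_tree_spectrum (N : ℕ) (𝒜 : Matrix (Fin N) (Fin N) ℝ)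
    (hnonneg : ∀ i j, 0 ≤ 𝒜 i j) (hdiag : ∀ i, 𝒜 i i = 0)
    (htree : ∃ r : Fin N, ∀ i : Fin N,
        Relation.ReflTransGen (fun u v : Fin N => 0 < 𝒜 v u) r i) :
    (Lap 𝒜).charpoly.rootMultiplicity 0 = 1 ∧
    ∀ μ : ℂ, ((Lap 𝒜).charpoly.map (algebraMap ℝ ℂ)).IsRoot μ → μ ≠ 0 → 0 < μ.re := by
  obtain ⟨r, hr⟩ := htree
  have : Nonempty (Fin N) := ⟨r⟩
  refine ⟨?_, fun μ hμ h0 => re_pos_of_isRoot_charpoly_Lap hnonneg hdiag hμ h0⟩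
  rw [← Matrix.charpoly_toLin', ← LinearMap.finrank_maxGenEigenspace_eq,
    maxGenEigenspace_Lap_zero hnonneg hdiag hr, finrank_span_singleton one_ne_zero]
end
end

section
/- Let 𝒜 = [a_{ij}] ∈ ℝ^{N×N}, N ≥ 2, with a_{ij} ≥ 0 and a_{ii} = 0, let L = [ℓ_{ij}] be its Laplacian, and assume the directed graph of 𝒜 contains a directed spanning tree. Define L̂ ∈ ℝ^{(N−1)×(N−1)} by L̂_{ij} = ℓ_{ij} − ℓ_{Nj} for 1 ≤ i, j ≤ N−1. Then every complex eigenvalue of L̂ has strictly positive real part; in particular L̂ is invertible. -/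
open Matrix Polynomial

noncomputable section

/-- Maximum modulus principle for the diffusion operator `z ↦ ∑ⱼ aᵢⱼ (zᵢ - zⱼ)` at an eigenvalue
with nonpositive real part. -/
theorem eq_root_of_norm_max {ι : Type*} [Fintype ι] {A : Matrix ι ι ℝ}
    (hA : ∀ i j, 0 ≤ A i j) {r : ι}
    (hr : ∀ i, Relation.ReflTransGen (fun u v : ι => 0 < A v u) r i)
    {z : ι → ℂ} {μ : ℂ} (hμ : μ.re ≤ 0)
    (hz : ∀ i, ∑ j, (A i j : ℂ) * (z i - z j) = μ * z i)
    {i : ι} (hi : ∀ j, ‖z j‖ ≤ ‖z i‖) : z i = z r ∧ μ * z i = 0 := by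
  have key : ∀ k, z k = z i → ∀ j, A k j = 0 ∨ z j = z i := by
    intro k hk
    have hterm : ∀ j, 0 ≤ 2 * (‖z i‖ ^ 2 - (z j * star (z i)).re) - ‖z i - z j‖ ^ 2 := by
      intro j
      have h1 := pow_le_pow_left₀ (norm_nonneg _) (hi j) 2
      simp only [Complex.sq_norm, Complex.normSq_apply, Complex.sub_re, Complex.sub_im,
        Complex.mul_re, Complex.star_def, Complex.conj_re, Complex.conj_im] at h1 ⊢
      nlinarith
    have hsum : ∑ j, A k j * (‖z i‖ ^ 2 - (z j * star (z i)).re) = μ.re * ‖z i‖ ^ 2 := by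
      have h := congrArg (fun w => (w * star (z i)).re) (hz k)
      simp only [hk, Finset.sum_mul, Complex.re_sum] at h
      convert h using 1
      · refine Finset.sum_congr rfl fun j _ => ?_
        simp only [Complex.sq_norm, Complex.normSq_apply, Complex.sub_re, Complex.sub_im,
          Complex.mul_re, Complex.mul_im, Complex.star_def, Complex.conj_re, Complex.conj_im,
          Complex.ofReal_re, Complex.ofReal_im]
        ring
      · simp only [Complex.sq_norm, Complex.normSq_apply,
          Complex.mul_re, Complex.mul_im, Complex.star_def, Complex.conj_re, Complex.conj_im]
        ring
    have hle : ∑ j, A k j * ‖z i - z j‖ ^ 2 ≤ 0 := by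
      have h : ∑ j, A k j * ‖z i - z j‖ ^ 2 ≤
          ∑ j, 2 * (A k j * (‖z i‖ ^ 2 - (z j * star (z i)).re)) :=
        Finset.sum_le_sum fun j _ => by nlinarith [mul_nonneg (hA k j) (hterm j)]
      rw [← Finset.mul_sum, hsum] at h
      nlinarith [mul_nonneg (neg_nonneg.2 hμ) (sq_nonneg ‖z i‖)]
    have hnn : ∀ j ∈ Finset.univ, 0 ≤ A k j * ‖z i - z j‖ ^ 2 :=
      fun j _ => mul_nonneg (hA k j) (sq_nonneg _)
    intro j
    have h0 := (Finset.sum_eq_zero_iff_of_nonneg hnn).1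
      (le_antisymm hle (Finset.sum_nonneg hnn)) j (Finset.mem_univ j)
    refine (mul_eq_zero.1 h0).imp_right fun h => ?_
    exact (sub_eq_zero.1 (norm_eq_zero.1 (pow_eq_zero_iff two_ne_zero |>.1 h))).symm
  constructor
  · have back : ∀ k, Relation.ReflTransGen (fun u v : ι => 0 < A v u) k i → z k = z i := by
      intro k hk
      induction hk using Relation.ReflTransGen.head_induction_on with
      | refl => rfl
      | head hab _ ih => exact (key _ ih _).resolve_left hab.ne'
    exact (back r (hr i)).symm
  · rw [← hz i]
    refine Finset.sum_eq_zero fun j _ => ?_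
    rcases key i rfl j with h | h <;> simp [h]

/-- The diffusion operator takes no nonzero constant value. -/
theorem diffusion_const_eq_zero {ι : Type*} [Fintype ι] [Nonempty ι] {A : Matrix ι ι ℝ}
    (hA : ∀ i j, 0 ≤ A i j) {x : ι → ℂ} {c : ℂ}
    (hx : ∀ i, ∑ j, (A i j : ℂ) * (x i - x j) = c) : c = 0 := by
  obtain ⟨i, hi⟩ := Finite.exists_min fun i => (x i * star c).re
  have h := congrArg (fun w => (w * star c).re) (hx i)
  simp only [Finset.sum_mul, Complex.re_sum] at h
  have hle : ∑ j, ((A i j : ℂ) * (x i - x j) * star c).re ≤ 0 := by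
    refine Finset.sum_nonpos fun j _ => ?_
    rw [mul_assoc, Complex.re_ofReal_mul, sub_mul, Complex.sub_re]
    exact mul_nonpos_of_nonneg_of_nonpos (hA i j) (sub_nonpos.2 (hi j))
  rw [h, Complex.star_def, Complex.mul_conj, Complex.ofReal_re] at hle
  exact Complex.normSq_eq_zero.1 (le_antisymm hle (Complex.normSq_nonneg c))

/-- Eigenvectors modulo constants of the diffusion operator, at an eigenvalue with nonpositive real
part, are constant. -/
theorem eq_root_of_diffusion_eq {ι : Type*} [Fintype ι] {A : Matrix ι ι ℝ}
    (hA : ∀ i j, 0 ≤ A i j) {r : ι}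
    (hr : ∀ i, Relation.ReflTransGen (fun u v : ι => 0 < A v u) r i)
    {x : ι → ℂ} {μ c : ℂ} (hμ : μ.re ≤ 0)
    (hx : ∀ i, ∑ j, (A i j : ℂ) * (x i - x j) = μ * x i + c) (k : ι) : x k = x r := by
  have : Nonempty ι := ⟨r⟩
  by_cases h0 : μ = 0
  · subst h0
    obtain rfl : c = 0 := diffusion_const_eq_zero hA (x := x) (by simpa using hx)
    obtain ⟨i, hi⟩ := Finite.exists_max fun i => ‖x i - x r‖
    have h := (eq_root_of_norm_max hA hr (z := fun i => x i - x r) hμ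
      (by simpa using hx) hi).1
    have hk := hi k
    simp only [h, sub_self, norm_zero] at hk
    exact sub_eq_zero.1 (norm_le_zero_iff.1 hk)
  · obtain ⟨i, hi⟩ := Finite.exists_max fun i => ‖x i + c / μ‖
    have h := (eq_root_of_norm_max hA hr (z := fun i => x i + c / μ) hμ
      (fun i => by simp only [add_sub_add_right_eq_sub, hx i]; field_simp) hi).2
    have hzero : ∀ j, x j + c / μ = 0 := by
      intro j
      have hj := hi j
      simp only [(mul_eq_zero.1 h).resolve_left h0, norm_zero] at hj
      exact norm_le_zero_iff.1 hj
    exact add_right_cancel ((hzero k).trans (hzero r).symm)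

theorem sum_Lap_mul {N : ℕ} {A : Matrix (Fin N) (Fin N) ℝ} (hdiag : ∀ i, A i i = 0)
    (x : Fin N → ℂ) (i : Fin N) :
    ∑ j, (Lap A i j : ℂ) * x j = ∑ j, (A i j : ℂ) * (x i - x j) := by
  have h : ∀ j, (Lap A i j : ℂ) * x j =
      (if i = j then (∑ k, (A i k : ℂ)) * x j else 0) - A i j * x j := by
    intro j
    by_cases hij : i = j
    · subst hij
      simp [Lap, hdiag]
    · simp [Lap, hij]
  simp only [h, mul_sub, Finset.sum_sub_distrib, Finset.sum_ite_eq, Finset.mem_univ, if_true,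
    Finset.sum_mul]

theorem exists_mulVec_eq_of_isRoot_charpoly {ι K : Type*} [Fintype ι] [DecidableEq ι] [Field K]
    {M : Matrix ι ι K} {μ : K} (h : M.charpoly.IsRoot μ) : ∃ v ≠ 0, M *ᵥ v = μ • v := by
  rw [Polynomial.IsRoot, Matrix.eval_charpoly] at h
  obtain ⟨v, hv, hMv⟩ := Matrix.exists_mulVec_eq_zero_iff.2 h
  refine ⟨v, hv, ?_⟩
  rw [Matrix.sub_mulVec, sub_eq_zero] at hMv
  rw [← hMv]
  ext i
  simp [Matrix.scalar_apply, Matrix.mulVec_diagonal]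

/-- If the directed graph of the nonnegative weight matrix `𝒜 ∈ ℝ^{N×N}`
(`N = n+1 ≥ 2`, zero diagonal) contains a directed spanning tree, then every
complex eigenvalue of the reduced Laplacian `L̂`, `L̂_{ij} = ℓ_{ij} − ℓ_{Nj}`,
has strictly positive real part; in particular `L̂` is invertible. -/
theorem reduced_laplacian_eigenvalues (n : ℕ) (hn : 1 ≤ n)
    (𝒜 : Matrix (Fin (n + 1)) (Fin (n + 1)) ℝ)
    (hnonneg : ∀ i j, 0 ≤ 𝒜 i j) (hdiag : ∀ i, 𝒜 i i = 0)
    (htree : ∃ r : Fin (n + 1), ∀ i : Fin (n + 1),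
        Relation.ReflTransGen (fun u v : Fin (n + 1) => 0 < 𝒜 v u) r i) :
    (∀ μ : ℂ,
      ((Matrix.of fun i j : Fin n =>
          Lap 𝒜 i.castSucc j.castSucc - Lap 𝒜 (Fin.last n) j.castSucc).charpoly.map
        (algebraMap ℝ ℂ)).IsRoot μ → 0 < μ.re) ∧
    (Matrix.of fun i j : Fin n =>
        Lap 𝒜 i.castSucc j.castSucc - Lap 𝒜 (Fin.last n) j.castSucc).det ≠ 0 := by
  obtain ⟨r, hr⟩ := htree
  have hpos : ∀ μ : ℂ,
      ((Matrix.of fun i j : Fin n =>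
          Lap 𝒜 i.castSucc j.castSucc - Lap 𝒜 (Fin.last n) j.castSucc).charpoly.map
        (algebraMap ℝ ℂ)).IsRoot μ → 0 < μ.re := by
    intro μ hroot
    by_contra! hμ
    rw [← Matrix.charpoly_map] at hroot
    obtain ⟨y, hy, hMy⟩ := exists_mulVec_eq_of_isRoot_charpoly hroot
    let x : Fin (n + 1) → ℂ := Fin.snoc y 0
    have hxc : ∀ i : Fin n, x i.castSucc = y i := fun i => by simp [x]
    have hxl : x (Fin.last n) = 0 := by simp [x]
    have hx : ∀ i, ∑ j, (𝒜 i j : ℂ) * (x i - x j) =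
        μ * x i + ∑ j, (Lap 𝒜 (Fin.last n) j : ℂ) * x j := by
      intro i
      rw [← sum_Lap_mul hdiag]
      refine Fin.lastCases ?_ (fun i => ?_) i
      · simp [hxl]
      · have h := congrFun hMy i
        simp only [Matrix.mulVec, dotProduct, Matrix.map_apply, Matrix.of_apply, Pi.smul_apply,
          smul_eq_mul, Complex.ofReal_sub, sub_mul, Finset.sum_sub_distrib, Complex.coe_algebraMap] at h
        simp only [Fin.sum_univ_castSucc, hxc, hxl, mul_zero, add_zero]
        exact sub_eq_iff_eq_add.1 h
    refine hy (funext fun i => ?_)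
    have hconst := eq_root_of_diffusion_eq hnonneg hr hμ hx
    rw [← hxc, hconst, ← hconst (Fin.last n), hxl, Pi.zero_apply]
  refine ⟨hpos, fun hdet => ?_⟩
  refine (hpos 0 ?_).ne' Complex.zero_re
  rw [Matrix.det_eq_sign_charpoly_coeff] at hdet
  have h0 := (mul_eq_zero.1 hdet).resolve_left (pow_ne_zero _ (neg_ne_zero.2 one_ne_zero))
  rw [Polynomial.IsRoot, ← Polynomial.coeff_zero_eq_eval_zero, Polynomial.coeff_map, h0, map_zero]
end
end

section
/- Let 𝒜 = [a_{ij}] ∈ ℝ^{N×N} with a_{ij} ≥ 0 and a_{ii} = 0, let L be its Laplacian, and let ι₁,…,ι_N ∈ {0,1} with root set 𝒞 = {i : ιᵢ = 1} nonempty. Assume that for every node i there exists a node r ∈ 𝒞 such that i is reachable from r by a directed path (or i = r). Then every complex eigenvalue of the expanded Laplacian L̄ = L + diag(ι₁,…,ι_N) has strictly positive real part; in particular L̄ is invertible. -/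
open Matrix Polynomial

noncomputable section

theorem expandedLap_map_mulVec_apply {N : ℕ} (A : Matrix (Fin N) (Fin N) ℝ)
    (hdiag : ∀ i, A i i = 0) (c : Fin N → ℝ) (v : Fin N → ℂ) (i : Fin N) :
    ((Lap A + Matrix.diagonal c).map (algebraMap ℝ ℂ) *ᵥ v) i =
      ((∑ k, A i k + c i : ℝ) : ℂ) * v i - ∑ k, (A i k : ℂ) * v k := by
  have hterm : ∀ k, (Lap A + Matrix.diagonal c).map (algebraMap ℝ ℂ) i k * v k =
      (if i = k then ((∑ l, A i l + c i : ℝ) : ℂ) * v i else 0) - (A i k : ℂ) * v k := by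
    intro k
    by_cases hik : i = k
    · subst hik
      simp [Lap, hdiag]
    · simp [Lap, hik]
  simp only [Matrix.mulVec, dotProduct, hterm, Finset.sum_sub_distrib]
  simp

/-- If `μ` has nonpositive real part, then at an index where an eigenvector of the expanded
Laplacian has maximal modulus there is no input, and every in-neighbour attains the maximum too. -/
theorem eq_zero_and_norm_eq_of_norm_max {N : ℕ} (A : Matrix (Fin N) (Fin N) ℝ)
    (hnonneg : ∀ i j, 0 ≤ A i j) (hdiag : ∀ i, A i i = 0) (c : Fin N → ℝ) (hc : ∀ i, 0 ≤ c i)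
    {μ : ℂ} (hμ : μ.re ≤ 0) {v : Fin N → ℂ}
    (hv : (Lap A + Matrix.diagonal c).map (algebraMap ℝ ℂ) *ᵥ v = μ • v)
    {i : Fin N} (hi : ∀ k, ‖v k‖ ≤ ‖v i‖) (hpos : 0 < ‖v i‖) :
    c i = 0 ∧ ∀ k, 0 < A i k → ‖v k‖ = ‖v i‖ := by
  have heq : (((∑ k, A i k + c i : ℝ) : ℂ) - μ) * v i = ∑ k, (A i k : ℂ) * v k := by
    have h := congrFun hv i
    rw [expandedLap_map_mulVec_apply A hdiag, Pi.smul_apply, smul_eq_mul] at h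
    linear_combination h
  have hle : (∑ k, A i k + c i) * ‖v i‖ ≤ ∑ k, A i k * ‖v k‖ := by
    calc (∑ k, A i k + c i) * ‖v i‖
        ≤ ‖((∑ k, A i k + c i : ℝ) : ℂ) - μ‖ * ‖v i‖ := by
          gcongr
          refine le_trans ?_ (Complex.re_le_norm _)
          rw [Complex.sub_re, Complex.ofReal_re]
          linarith
      _ = ‖∑ k, (A i k : ℂ) * v k‖ := by rw [← norm_mul, heq]
      _ ≤ ∑ k, ‖(A i k : ℂ) * v k‖ := norm_sum_le _ _
      _ = ∑ k, A i k * ‖v k‖ := by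
          simp only [norm_mul, Complex.norm_real, Real.norm_of_nonneg (hnonneg i _)]
  have hterm : ∀ k ∈ Finset.univ, 0 ≤ A i k * (‖v i‖ - ‖v k‖) := fun k _ =>
    mul_nonneg (hnonneg i k) (sub_nonneg.2 (hi k))
  have hsum : ∑ k, A i k * (‖v i‖ - ‖v k‖) + c i * ‖v i‖ ≤ 0 := by
    simp only [mul_sub, Finset.sum_sub_distrib, ← Finset.sum_mul]
    linarith
  have hsum_nonneg := Finset.sum_nonneg hterm
  have hci : 0 ≤ c i * ‖v i‖ := mul_nonneg (hc i) hpos.le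
  refine ⟨(mul_eq_zero.1 (by linarith : c i * ‖v i‖ = 0)).resolve_right hpos.ne', fun k hk => ?_⟩
  have hzero := (Finset.sum_eq_zero_iff_of_nonneg hterm).1 (by linarith) k (Finset.mem_univ k)
  linarith [(mul_eq_zero.1 hzero).resolve_left hk.ne']

theorem expandedLap_re_pos {N : ℕ} (A : Matrix (Fin N) (Fin N) ℝ)
    (hnonneg : ∀ i j, 0 ≤ A i j) (hdiag : ∀ i, A i i = 0) (c : Fin N → ℝ) (hc : ∀ i, 0 ≤ c i)
    (hreach : ∀ i : Fin N, ∃ r : Fin N, 0 < c r ∧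
        Relation.ReflTransGen (fun u v : Fin N => 0 < A v u) r i)
    {μ : ℂ} {v : Fin N → ℂ} (hv0 : v ≠ 0)
    (hv : (Lap A + Matrix.diagonal c).map (algebraMap ℝ ℂ) *ᵥ v = μ • v) : 0 < μ.re := by
  by_contra! hμ
  obtain ⟨j, hj⟩ := Function.ne_iff.1 hv0
  have : Nonempty (Fin N) := ⟨j⟩
  obtain ⟨i, hi⟩ := Finite.exists_max fun k => ‖v k‖
  have hpos : 0 < ‖v i‖ := (norm_pos_iff.2 hj).trans_le (hi j)
  obtain ⟨r, hr, hpath⟩ := hreach i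
  have hmax : ‖v r‖ = ‖v i‖ := by
    clear hr
    induction hpath using Relation.ReflTransGen.head_induction_on with
    | refl => rfl
    | head huw _ ih =>
      exact ((eq_zero_and_norm_eq_of_norm_max A hnonneg hdiag c hc hμ hv
        (fun k => ih ▸ hi k) (ih ▸ hpos)).2 _ huw).trans ih
  exact hr.ne' (eq_zero_and_norm_eq_of_norm_max A hnonneg hdiag c hc hμ hv
    (fun k => hmax ▸ hi k) (hmax ▸ hpos)).1

/-- If every node of the directed graph of the nonnegative weight matrix `𝒜`
(zero diagonal) is reachable by a directed path from some node of the nonempty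
root set `𝒞 = {i : ιᵢ = 1}`, then every complex eigenvalue of the expanded
Laplacian `L̄ = L + diag(ι)` has strictly positive real part; in particular `L̄`
is invertible. -/
theorem expanded_laplacian_eigenvalues (N : ℕ) (𝒜 : Matrix (Fin N) (Fin N) ℝ)
    (hnonneg : ∀ i j, 0 ≤ 𝒜 i j) (hdiag : ∀ i, 𝒜 i i = 0)
    (ι : Fin N → ℝ) (hι : ∀ i, ι i = 0 ∨ ι i = 1) (hroot : ∃ i, ι i = 1)
    (hreach : ∀ i : Fin N, ∃ r : Fin N, ι r = 1 ∧
        Relation.ReflTransGen (fun u v : Fin N => 0 < 𝒜 v u) r i) :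
    (∀ μ : ℂ,
      (((Lap 𝒜 + Matrix.diagonal ι).charpoly).map (algebraMap ℝ ℂ)).IsRoot μ →
        0 < μ.re) ∧
    (Lap 𝒜 + Matrix.diagonal ι).det ≠ 0 := by
  have hre : ∀ μ : ℂ,
      (((Lap 𝒜 + Matrix.diagonal ι).charpoly).map (algebraMap ℝ ℂ)).IsRoot μ → 0 < μ.re := by
    intro μ hμ
    rw [← Matrix.charpoly_map, Polynomial.IsRoot, Matrix.eval_charpoly,
      ← Matrix.exists_mulVec_eq_zero_iff] at hμ
    obtain ⟨v, hv0, hv⟩ := hμ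
    refine expandedLap_re_pos 𝒜 hnonneg hdiag ι
      (fun i => by rcases hι i with h | h <;> simp [h]) (fun i => ?_) hv0 ?_
    · obtain ⟨r, hr, hpath⟩ := hreach i
      exact ⟨r, hr ▸ one_pos, hpath⟩
    · rw [Matrix.sub_mulVec, sub_eq_zero] at hv
      rw [← hv]
      ext i
      simp [Matrix.scalar_apply, Matrix.mulVec_diagonal]
  refine ⟨hre, fun hdet => ?_⟩
  have h0 : (((Lap 𝒜 + Matrix.diagonal ι).charpoly).map (algebraMap ℝ ℂ)).IsRoot 0 := by
    rw [← map_zero (algebraMap ℝ ℂ)]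
    refine Polynomial.IsRoot.map ?_
    rw [Polynomial.IsRoot, Matrix.eval_charpoly, map_zero, zero_sub, Matrix.det_neg, hdet, mul_zero]
  simpa using hre 0 h0
end
end

section
/- Consider the disturbed closed loop of Theorem 1 with N ≥ 2 agents: x̄ᵢ' = Āx̄ᵢ + B̄(vᵢ + Γx̄ᵢ) + Ēᵢω̄ᵢ(t), yᵢ = C̄x̄ᵢ, x̂ᵢ' = Āx̂ᵢ − ε^{−n_q}B̄FΔ(ε)ζ̂ᵢ + B̄Γx̂ᵢ + ε^{−1}K(ζᵢ − C̄x̂ᵢ), χᵢ' = Āχᵢ + B̄vᵢ + B̄Γχᵢ + ε^{−1}(x̂ᵢ − ζ̂ᵢ), vᵢ = −ε^{−n_q}FΔ(ε)χᵢ, with ζᵢ = Σⱼℓ_{ij}yⱼ and ζ̂ᵢ = Σⱼℓ_{ij}χⱼ. Define the stacked difference variables x̃ = (x̄₁ − x̄_N; … ; x̄_{N−1} − x̄_N) and x̂̃ = (x̂₁ − x̂_N; … ; x̂_{N−1} − x̂_N), let L̂ ∈ ℝ^{(N−1)×(N−1)} with L̂_{ij} = ℓ_{ij} − ℓ_{Nj},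 Π = [I_{N−1}, −𝟏] ∈ ℝ^{(N−1)×N}, Ē = diag(Ē₁,…,Ē_N), and ω̄ = (ω̄₁; … ; ω̄_N). Then for every differentiable solution, the variable ē := (L̂ ⊗ I) x̃ − x̂̃ satisfies the decoupled linear equation ē'(t) = (I_{N−1} ⊗ (Ā + B̄Γ − ε^{−1}KC̄)) ē(t) + (L̂Π ⊗ I) Ē ω̄(t) for all t; in particular the ē-dynamics are driven only by the disturbance and not by x̃ or χ. -/
open Matrix

noncomputable section

/-- State index: `n_q` blocks of size `p`. -/
abbrev Jx (p nq : ℕ) := Fin nq × Fin p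

/-- `Ā`: the block upper-shift matrix `[[0, I_{p(n_q−1)}],[0, 0]]`. -/
def A0 (p nq : ℕ) : Matrix (Jx p nq) (Jx p nq) ℝ :=
  Matrix.of fun ki lj => if lj.1.val = ki.1.val + 1 ∧ lj.2 = ki.2 then (1:ℝ) else 0

/-- `B̄ = [0; I_p]` (identity in the last block). -/
def B0 (p nq : ℕ) : Matrix (Jx p nq) (Fin p) ℝ :=
  Matrix.of fun ki j => if ki.1.val = nq - 1 ∧ ki.2 = j then (1:ℝ) else 0

/-- `C̄ = [I_p, 0]`. -/
def C0 (p nq : ℕ) : Matrix (Fin p) (Jx p nq) ℝ :=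
  Matrix.of fun i kj => if kj.1.val = 0 ∧ kj.2 = i then (1:ℝ) else 0

/-- `Δ(ε) = diag(I_p, εI_p, …, ε^{n_q−1}I_p)`. -/
def D0 (p nq : ℕ) (ε : ℝ) : Matrix (Jx p nq) (Jx p nq) ℝ :=
  Matrix.diagonal fun ki => ε ^ ki.1.val

/-- Reduced Laplacian `L̂_{ij} = ℓ_{ij} − ℓ_{Nj}`. -/
def Lhat {n : ℕ} (L : Matrix (Fin (n + 1)) (Fin (n + 1)) ℝ) : Matrix (Fin n) (Fin n) ℝ :=
  Matrix.of fun i j => L i.castSucc j.castSucc - L (Fin.last n) j.castSucc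

/-- `Π = [I_{N−1}, −𝟏]`. -/
def Pim (n : ℕ) : Matrix (Fin n) (Fin (n + 1)) ℝ :=
  Matrix.of fun i j => if j = Fin.last n then (-1 : ℝ) else if j = i.castSucc then 1 else 0

theorem Lap_row_sum {N : ℕ} {A : Matrix (Fin N) (Fin N) ℝ} (hA : ∀ i, A i i = 0) (i : Fin N) :
    ∑ j, Lap A i j = 0 := by
  have h : ∀ j, Lap A i j = (if i = j then ∑ k, A i k else 0) - A i j := by
    intro j
    by_cases hij : i = j
    · subst hij
      simp [Lap, hA]
    · simp [Lap, hij]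
  simp [h]

/-- `L̂ (u_j − u_N)_j = Π L u` when the rows of `L` sum to zero. -/
theorem sum_Lhat_smul_sub {M : Type*} [AddCommGroup M] [Module ℝ M] {n : ℕ}
    {L : Matrix (Fin (n + 1)) (Fin (n + 1)) ℝ} (hL : ∀ i, ∑ j, L i j = 0)
    (i : Fin n) (u : Fin (n + 1) → M) :
    ∑ j : Fin n, Lhat L i j • (u j.castSucc - u (Fin.last n)) =
      ∑ k, (L i.castSucc k - L (Fin.last n) k) • u k := by
  have hlast : ∀ r, L r (Fin.last n) = -∑ j : Fin n, L r j.castSucc := by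
    intro r
    have h := hL r
    rw [Fin.sum_univ_castSucc] at h
    linarith
  rw [Fin.sum_univ_castSucc, hlast, hlast]
  simp only [Lhat, of_apply, smul_sub, Finset.sum_sub_distrib, ← Finset.sum_smul]
  module

/-- `L̂ Π = Π L` when the rows of `L` sum to zero. -/
theorem Lhat_mul_Pim_apply {n : ℕ} {L : Matrix (Fin (n + 1)) (Fin (n + 1)) ℝ}
    (hL : ∀ i, ∑ j, L i j = 0) (i : Fin n) (k : Fin (n + 1)) :
    (Lhat L * Pim n) i k = L i.castSucc k - L (Fin.last n) k := by
  have hPim : ∀ j : Fin n, Pim n j k =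
      (Pi.single k (1 : ℝ) : Fin (n + 1) → ℝ) j.castSucc -
        (Pi.single k (1 : ℝ) : Fin (n + 1) → ℝ) (Fin.last n) := by
    intro j
    rcases eq_or_ne k (Fin.last n) with rfl | hk
    · simp [Pim, (Fin.castSucc_lt_last j).ne]
    · simp [Pim, Pi.single_apply, hk, hk.symm, eq_comm]
  have h := sum_Lhat_smul_sub hL i (Pi.single k (1 : ℝ))
  simpa [mul_apply, hPim, Pi.single_apply] using h

/-- **Decoupled observer-error dynamics** (Step 2 of the proof of Theorem 1):
along every solution of the disturbed closed loop, the variable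
`ē = (L̂ ⊗ I) x̃ − x̂̃` satisfies
`ē' = (I ⊗ (Ā + B̄Γ − ε^{-1}KC̄)) ē + (L̂Π ⊗ I) Ē ω̄`;
in particular the `ē`-dynamics are driven only by the disturbance. -/
theorem decoupled_observer_error (p nq : ℕ) (hp : 1 ≤ p) (hnq : 1 ≤ nq)
    (Γ F : Matrix (Fin p) (Jx p nq) ℝ) (K : Matrix (Jx p nq) (Fin p) ℝ)
    (ε : ℝ) (hε : 0 < ε)
    (n : ℕ) (hn : 1 ≤ n)
    (𝒜 : Matrix (Fin (n + 1)) (Fin (n + 1)) ℝ)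
    (hnonneg : ∀ i j, 0 ≤ 𝒜 i j) (hdiag : ∀ i, 𝒜 i i = 0)
    (q : Fin (n + 1) → ℕ) (E : ∀ i : Fin (n + 1), Matrix (Jx p nq) (Fin (q i)) ℝ)
    (ω : ∀ i : Fin (n + 1), ℝ → (Fin (q i) → ℝ)) (hω : ∀ i, Continuous (ω i))
    (xb xh χ : Fin (n + 1) → ℝ → (Jx p nq → ℝ))
    -- closed-loop equations with disturbances
    (hxb : ∀ i t, HasDerivAt (xb i)
        ((A0 p nq).mulVec (xb i t) +
         (B0 p nq).mulVec
           (-((ε ^ nq)⁻¹ • (F * D0 p nq ε).mulVec (χ i t)) + Γ.mulVec (xb i t))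
         + (E i).mulVec (ω i t)) t)
    (hxh : ∀ i t, HasDerivAt (xh i)
        ((A0 p nq).mulVec (xh i t)
         - (ε ^ nq)⁻¹ • (B0 p nq * F * D0 p nq ε).mulVec
             (∑ j, Lap 𝒜 i j • χ j t)
         + (B0 p nq * Γ).mulVec (xh i t)
         + ε⁻¹ • K.mulVec
             ((∑ j, Lap 𝒜 i j • (C0 p nq).mulVec (xb j t))
               - (C0 p nq).mulVec (xh i t))) t)
    (hχ : ∀ i t, HasDerivAt (χ i)
        ((A0 p nq).mulVec (χ i t)
         + (B0 p nq).mulVec (-((ε ^ nq)⁻¹ • (F * D0 p nq ε).mulVec (χ i t)))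
         + (B0 p nq * Γ).mulVec (χ i t)
         + ε⁻¹ • (xh i t - ∑ j, Lap 𝒜 i j • χ j t)) t) :
    -- the decoupled observer-error equation, componentwise over i ∈ {1,…,N−1}
    ∀ i : Fin n, ∀ t : ℝ,
      HasDerivAt
        (fun s =>
          (∑ j : Fin n, Lhat (Lap 𝒜) i j •
              (xb j.castSucc s - xb (Fin.last n) s))
            - (xh i.castSucc s - xh (Fin.last n) s))
        ((A0 p nq + B0 p nq * Γ - ε⁻¹ • (K * C0 p nq)).mulVec
            ((∑ j : Fin n, Lhat (Lap 𝒜) i j •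
               (xb j.castSucc t - xb (Fin.last n) t))
              - (xh i.castSucc t - xh (Fin.last n) t))
          + ∑ k : Fin (n + 1), (Lhat (Lap 𝒜) * Pim n) i k • (E k).mulVec (ω k t)) t := by
  intro i t
  have hL := Lap_row_sum hdiag
  have hsum := fun s => sum_Lhat_smul_sub hL i (fun k => xb k s)
  simp only [hsum, Lhat_mul_Pim_apply hL]
  have hder := (HasDerivAt.fun_sum (u := Finset.univ) fun k _ =>
    (hxb k t).fun_const_smul (Lap 𝒜 i.castSucc k - Lap 𝒜 (Fin.last n) k)).fun_sub
      ((hxh i.castSucc t).fun_sub (hxh (Fin.last n) t))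
  refine hder.congr_deriv ?_
  simp only [add_mulVec, sub_mulVec, smul_mulVec, mulVec_add, mulVec_sub, mulVec_neg, mulVec_smul,
    mulVec_sum, mulVec_mulVec, smul_add, smul_neg, smul_sub, sub_smul, Finset.sum_add_distrib,
    Finset.sum_sub_distrib, Finset.sum_neg_distrib, Finset.smul_sum, smul_comm (_ : ℝ) (ε ^ nq)⁻¹,
    Matrix.mul_assoc, smul_comm (_ : ℝ) ε⁻¹]
  abel
end
end
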